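/- arXiv:2006.08272 — 2 statements merged into one kernel-verified Lean document; each statement's English description precedes it below -/
import Mathlib

section
/- If f(x) = g(A·x) for polynomials f, g in n variables and A ∈ GL(n, F), then the Lie algebra of f equals A⁻¹ · (Lie algebra of g) · A, i.e., 𝔤_f = A⁻¹ 𝔤_g A. -/
open Matrix MvPolynomial

/-- The Lie algebra of a polynomial `f`: the set of matrices `E` with
`∑ i j, E i j • x_j ∂f/∂x_i = 0`. -/
def lieAlg {F : Type*} [Field F] {σ : Type*} [Fintype σ] [DecidableEq σ]
    (f : MvPolynomial σ F) : Set (Matrix σ σ F) :=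
  {E | ∑ i : σ, ∑ j : σ, E i j • (MvPolynomial.X j * MvPolynomial.pderiv i f) = 0}

section LinearSubstitution

variable {R σ : Type*} [CommRing R] [Fintype σ]

/-- The derivation `∑ i j, E i j x_j ∂/∂x_i` attached to a matrix `E`. -/
noncomputable def matrixDerivation (E : Matrix σ σ R) :
    Derivation R (MvPolynomial σ R) (MvPolynomial σ R) :=
  ∑ i, (∑ j, C (E i j) * X j : MvPolynomial σ R) • pderiv i

/-- The substitution `x ↦ A x` on polynomials. -/
noncomputable def linearSubst (A : Matrix σ σ R) : MvPolynomial σ R →ₐ[R] MvPolynomial σ R :=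
  aeval fun i => ∑ j, C (A i j) * X j

theorem linearSubst_X (A : Matrix σ σ R) (i : σ) :
    linearSubst A (X i) = ∑ j, C (A i j) * X j := by
  simp [linearSubst]

theorem linearSubst_C (A : Matrix σ σ R) (r : R) : linearSubst A (C r) = C r :=
  (linearSubst A).commutes r

theorem matrixDerivation_eq_sum (E : Matrix σ σ R) (p : MvPolynomial σ R) :
    matrixDerivation E p = ∑ i, (∑ j, C (E i j) * X j) * pderiv i p := by
  simp only [matrixDerivation, ← Derivation.coeFnAddMonoidHom_apply, map_sum, Finset.sum_apply]
  rfl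

theorem matrixDerivation_apply (E : Matrix σ σ R) (p : MvPolynomial σ R) :
    matrixDerivation E p = ∑ i, ∑ j, E i j • (X j * pderiv i p) := by
  simp only [matrixDerivation_eq_sum, Finset.sum_mul, smul_eq_C_mul, mul_assoc]

theorem matrixDerivation_X [DecidableEq σ] (E : Matrix σ σ R) (i : σ) :
    matrixDerivation E (X i) = ∑ j, C (E i j) * X j := by
  simp [matrixDerivation_eq_sum, pderiv_X, Pi.single_apply]

theorem sum_C_mul_sum_C_mul_X (A B : Matrix σ σ R) (i : σ) :
    ∑ j, C (A i j) * ∑ k, C (B j k) * X k = ∑ k, C ((A * B) i k) * (X k : MvPolynomial σ R) := by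
  simp only [Matrix.mul_apply, map_sum, C_mul, Finset.mul_sum, Finset.sum_mul, mul_assoc]
  exact Finset.sum_comm

theorem linearSubst_linearSubst (A B : Matrix σ σ R) (p : MvPolynomial σ R) :
    linearSubst B (linearSubst A p) = linearSubst (A * B) p := by
  suffices (linearSubst B).comp (linearSubst A) = linearSubst (A * B) from
    DFunLike.congr_fun this p
  ext1 i
  simp only [AlgHom.comp_apply, linearSubst_X, map_sum, map_mul, linearSubst_C,
    sum_C_mul_sum_C_mul_X]

theorem linearSubst_one [DecidableEq σ] (p : MvPolynomial σ R) :
    linearSubst (1 : Matrix σ σ R) p = p := by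
  suffices linearSubst (1 : Matrix σ σ R) = AlgHom.id R _ from DFunLike.congr_fun this p
  ext1 i
  simp [linearSubst_X, Matrix.one_apply, apply_ite C]

theorem linearSubst_injective [DecidableEq σ] {A : Matrix σ σ R} (hA : IsUnit A.det) :
    Function.Injective (linearSubst A) :=
  Function.LeftInverse.injective (g := linearSubst A⁻¹) fun p => by
    rw [linearSubst_linearSubst, Matrix.mul_nonsing_inv _ hA, linearSubst_one]

theorem matrixDerivation_linearSubst {A E E' : Matrix σ σ R} (h : A * E' = E * A)
    (p : MvPolynomial σ R) :
    matrixDerivation E' (linearSubst A p) = linearSubst A (matrixDerivation E p) := by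
  classical
  induction p using MvPolynomial.induction_on with
  | C r => simp [← algebraMap_eq]
  | add p q hp hq => simp only [map_add, hp, hq]
  | mul_X p i hp =>
    have hX : matrixDerivation E' (linearSubst A (X i)) =
        linearSubst A (matrixDerivation E (X i)) := by
      simp only [linearSubst_X, matrixDerivation_X, map_sum, C_mul',
        Derivation.map_smul, map_smul]
      simp only [← C_mul', sum_C_mul_sum_C_mul_X, h]
    simp only [map_mul, Derivation.leibniz, smul_eq_mul, map_add, hp, hX]

theorem matrixDerivation_linearSubst_eq_zero_iff [DecidableEq σ] {A E E' : Matrix σ σ R}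
    (hA : IsUnit A.det) (h : A * E' = E * A) (p : MvPolynomial σ R) :
    matrixDerivation E' (linearSubst A p) = 0 ↔ matrixDerivation E p = 0 := by
  rw [matrixDerivation_linearSubst h, map_eq_zero_iff _ (linearSubst_injective hA)]

end LinearSubstitution

theorem mem_lieAlg_iff {F σ : Type*} [Field F] [Fintype σ] [DecidableEq σ]
    (f : MvPolynomial σ F) (E : Matrix σ σ F) :
    E ∈ lieAlg f ↔ matrixDerivation E f = 0 := by
  rw [matrixDerivation_apply]
  rfl

theorem stmt4 (F : Type*) [Field F] (n : ℕ)
    (f g : MvPolynomial (Fin n) F) (A : Matrix (Fin n) (Fin n) F)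
    (hA : IsUnit A.det)
    (hf : f = MvPolynomial.aeval
        (fun i => ∑ j, MvPolynomial.C (A i j) * MvPolynomial.X j) g) :
    lieAlg f = (fun E => A⁻¹ * E * A) '' lieAlg g := by
  change f = linearSubst A g at hf
  subst hf
  have key (E E' : Matrix (Fin n) (Fin n) F) (h : A * E' = E * A) :
      E' ∈ lieAlg (linearSubst A g) ↔ E ∈ lieAlg g := by
    rw [mem_lieAlg_iff, mem_lieAlg_iff, matrixDerivation_linearSubst_eq_zero_iff hA h]
  ext E'
  constructor
  · intro hE
    refine ⟨A * E' * A⁻¹, (key _ _ ?_).1 hE, ?_⟩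
    · rw [Matrix.nonsing_inv_mul_cancel_right _ _ hA]
    · simp only [Matrix.mul_assoc, Matrix.nonsing_inv_mul _ hA, Matrix.mul_one,
        Matrix.nonsing_inv_mul_cancel_left _ _ hA]
  · rintro ⟨E, hE, rfl⟩
    refine (key _ _ ?_).2 hE
    simp only [Matrix.mul_assoc, Matrix.mul_nonsing_inv_cancel_left _ _ hA]
end

section
/- Let f be a nonzero d-tensor in the variable sets x_0,...,x_{d-1} (each monomial contains exactly one variable from each x_k) such that B_k ⊆ 𝔤_f for every k ∈ {0,...,d-1}. Then there exists a nonzero scalar α ∈ F such that f = α · Tr-IMM_{w,d}. In other words, Tr-IMM_{w,d} is characterized up to scalar among set-multilinear polynomials by containing the spaces B_0,...,B_{d-1} in its Lie algebra. -/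
open Matrix MvPolynomial

/-- The `k`-th symbolic matrix `Q_k` of `Tr-IMM_{w,d}`. -/
noncomputable def symQ (F : Type*) [Field F] (w d : ℕ) (k : Fin d) :
    Matrix (Fin w) (Fin w) (MvPolynomial (Fin d × Fin w × Fin w) F) :=
  fun i j => MvPolynomial.X (k, i, j)

/-- `Tr-IMM_{w,d} = tr(Q_0 Q_1 ⋯ Q_{d-1})`. -/
noncomputable def trIMM (F : Type*) [Field F] (w d : ℕ) :
    MvPolynomial (Fin d × Fin w × Fin w) F :=
  Matrix.trace (((List.finRange d).map (symQ F w d)).prod)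

/-- The block-diagonal matrix of the space `B_k` associated to `M ∈ M_w(F)`:
the row indexed by `x^{(k)}_{i,j}` carries the linear form `(Q_k · M)_{i,j}` and
the row indexed by `x^{(k+1)}_{i,j}` carries `(−M · Q_{k+1})_{i,j}` (this is the
coordinate form of `diag(I_w ⊗ Mᵀ, −I_w ⊗ M)` and its variants under the
paper's variable ordering). -/
def Bmat (F : Type*) [Field F] (w d : ℕ) [NeZero d] (k : Fin d)
    (M : Matrix (Fin w) (Fin w) F) :
    Matrix (Fin d × Fin w × Fin w) (Fin d × Fin w × Fin w) F :=
  fun a b =>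
    if a.1 = k ∧ b.1 = k then (if a.2.1 = b.2.1 then M b.2.2 a.2.2 else 0)
    else if a.1 = k + 1 ∧ b.1 = k + 1 then
      (if a.2.2 = b.2.2 then - M a.2.1 b.2.1 else 0)
    else 0

/-- The exponent vector of the set-multilinear monomial `∏ k, x_(k, s k)`. -/
noncomputable def selectionExp {κ U : Type*} [Fintype κ] [Fintype U] [DecidableEq U]
    (s : κ → U) : κ × U →₀ ℕ :=
  Finsupp.equivFunOnFinite.symm fun v => if s v.1 = v.2 then 1 else 0

section Selection

variable {κ U : Type*} [Fintype κ] [Fintype U] [DecidableEq U]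

@[simp]
theorem selectionExp_apply (s : κ → U) (v : κ × U) :
    selectionExp s v = if s v.1 = v.2 then 1 else 0 := rfl

theorem selectionExp_injective :
    Function.Injective (selectionExp : (κ → U) → (κ × U →₀ ℕ)) := by
  intro s t h
  funext k
  have h1 := DFunLike.congr_fun h (k, s k)
  by_contra hne
  simp [Ne.symm hne] at h1

theorem selectionExp_sub_add_single [DecidableEq κ] (s : κ → U) (k : κ) (u : U) :
    selectionExp s - Finsupp.single (k, s k) 1 + Finsupp.single (k, u) 1 =
      selectionExp (Function.update s k u) := by
  ext ⟨l, a⟩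
  by_cases hl : l = k
  · subst hl
    by_cases h1 : s l = a <;> by_cases h2 : u = a <;>
      simp [h1, h2]
  · simp [Function.update_of_ne hl, Ne.symm hl]

theorem exists_eq_selectionExp (m : κ × U →₀ ℕ) (hm : ∀ k, ∑ u, m (k, u) = 1) :
    ∃ s : κ → U, m = selectionExp s := by
  classical
  have key : ∀ k, ∃ u, ∀ v, m (k, v) = if u = v then 1 else 0 := by
    intro k
    obtain ⟨u, -, hu⟩ := Finset.exists_ne_zero_of_sum_ne_zero
      (by rw [hm k]; exact one_ne_zero : ∑ u, m (k, u) ≠ 0)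
    have hsum := hm k
    rw [← Finset.add_sum_erase _ _ (Finset.mem_univ u)] at hsum
    have hrest : ∑ v ∈ Finset.univ.erase u, m (k, v) = 0 := by omega
    refine ⟨u, fun v => ?_⟩
    split_ifs with h
    · subst h; omega
    · exact Finset.sum_eq_zero_iff.mp hrest v
        (Finset.mem_erase.mpr ⟨Ne.symm h, Finset.mem_univ v⟩)
  choose s hs using key
  exact ⟨s, by ext ⟨k, v⟩; simp [hs]⟩

/-- The set-multilinear coefficients of the identity saying that a layer-preserving matrix
lies in the Lie algebra of `f`. -/
theorem sum_coeff_update_eq_zero [DecidableEq κ] {F : Type*} [Field F]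
    {f : MvPolynomial (κ × U) F} {E : Matrix (κ × U) (κ × U) F} (hE : E ∈ lieAlg f)
    (hblock : ∀ a b, a.1 ≠ b.1 → E a b = 0) (s : κ → U) :
    ∑ k, ∑ u, E (k, u) (k, s k) * coeff (selectionExp (Function.update s k u)) f = 0 := by
  have h := congrArg (coeff (selectionExp s)) (show _ = _ from hE)
  simp only [coeff_sum, coeff_smul, coeff_zero, smul_eq_mul] at h
  rw [← h, Fintype.sum_prod_type]
  refine Finset.sum_congr rfl fun k _ => Finset.sum_congr rfl fun u _ => ?_
  rw [Finset.sum_eq_single (k, s k)]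
  · rw [coeff_X_mul', if_pos (by simp), coeff_pderiv, selectionExp_sub_add_single]
    have : (selectionExp s - Finsupp.single (k, s k) 1 : κ × U →₀ ℕ) (k, u) = 0 := by
      by_cases hu : s k = u <;> simp [hu]
    rw [this, Nat.cast_zero, zero_add, mul_one]
  · rintro ⟨l, v⟩ - hne
    by_cases hl : k = l
    · subst hl
      rw [coeff_X_mul', if_neg, mul_zero]
      have : s k ≠ v := fun h => hne (by rw [h])
      simpa using this
    · rw [hblock _ _ hl, zero_mul]
  · simp

end Selection

/-- A product of matrices, entrywise, as a sum over the intermediate indices. -/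
theorem list_ofFn_prod_apply {ι R : Type*} [Fintype ι] [DecidableEq ι] [CommRing R] {n : ℕ}
    (A : Fin (n + 1) → Matrix ι ι R) (i j : ι) :
    (List.ofFn A).prod i j =
      ∑ q : Fin n → ι, ∏ k, A k (Fin.cons (α := fun _ => ι) i q k)
        (Fin.snoc (α := fun _ => ι) q j k) := by
  induction n generalizing i with
  | zero =>
    simp [Fin.snoc]
  | succ n ih =>
    rw [List.ofFn_succ, List.prod_cons, Matrix.mul_apply,
      ← (Fin.consEquiv fun _ : Fin (n + 1) => ι).sum_comp, Fintype.sum_prod_type]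
    refine Finset.sum_congr rfl fun l _ => ?_
    rw [ih, Finset.mul_sum]
    refine Finset.sum_congr rfl fun q _ => ?_
    rw [Fin.prod_univ_succ (n := n + 1)]
    simp only [Fin.consEquiv, Equiv.coe_fn_mk, ← Fin.cons_snoc_eq_snoc_cons, Fin.cons_zero,
      Fin.cons_succ]

theorem trace_list_ofFn_prod {ι R : Type*} [Fintype ι] [DecidableEq ι] [CommRing R] {n : ℕ}
    (A : Fin (n + 1) → Matrix ι ι R) :
    ((List.ofFn A).prod).trace = ∑ p : Fin (n + 1) → ι, ∏ k, A k (p k) (p (k + 1)) := by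
  rw [← (Fin.consEquiv fun _ : Fin (n + 1) => ι).sum_comp, Fintype.sum_prod_type, Matrix.trace]
  refine Finset.sum_congr rfl fun i _ => ?_
  rw [Matrix.diag_apply, list_ofFn_prod_apply]
  refine Finset.sum_congr rfl fun q _ => Finset.prod_congr rfl fun k _ => ?_
  congr 1
  induction k using Fin.lastCases with
  | last => simp [Fin.consEquiv]
  | cast k => simp [Fin.consEquiv, Fin.coeSucc_eq_succ]

/-- The selection of variables in the path monomial through the vertices `p`. -/
def pathSelection {w d : ℕ} [NeZero d] (p : Fin d → Fin w) (k : Fin d) : Fin w × Fin w :=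
  (p k, p (k + 1))

theorem pathSelection_injective {w d : ℕ} [NeZero d] :
    Function.Injective (pathSelection : (Fin d → Fin w) → _) := fun _ _ h =>
  funext fun k => congrArg Prod.fst (congrFun h k)

theorem trIMM_eq_sum (F : Type*) [Field F] (w d : ℕ) [NeZero d] :
    trIMM F w d = ∑ p : Fin d → Fin w, monomial (selectionExp (pathSelection p)) 1 := by
  obtain ⟨n, rfl⟩ := Nat.exists_eq_succ_of_ne_zero (NeZero.ne d)
  rw [trIMM, ← List.ofFn_eq_map, trace_list_ofFn_prod]
  refine Finset.sum_congr rfl fun p _ => ?_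
  have hexp : selectionExp (pathSelection p) =
      ∑ k, Finsupp.single (k, pathSelection p k) 1 := by
    ext ⟨l, u⟩
    rw [Finsupp.finsetSum_apply, Finset.sum_eq_single l]
    · simp [Finsupp.single_apply]
    · intro k _ hk
      simp [hk]
    · simp
  rw [hexp, monomial_sum_one]
  rfl

theorem coeff_trIMM (F : Type*) [Field F] (w d : ℕ) [NeZero d] (m) :
    coeff m (trIMM F w d) =
      ∑ p : Fin d → Fin w, if selectionExp (pathSelection p) = m then 1 else 0 := by
  classical
  rw [trIMM_eq_sum, coeff_sum]
  exact Finset.sum_congr rfl fun p _ => by rw [coeff_monomial]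

theorem Bmat_left {F : Type*} [Field F] {w d : ℕ} [NeZero d] (k : Fin d)
    (M : Matrix (Fin w) (Fin w) F) (u v : Fin w × Fin w) :
    Bmat F w d k M (k, u) (k, v) = if u.1 = v.1 then M v.2 u.2 else 0 :=
  if_pos ⟨rfl, rfl⟩

theorem Bmat_right {F : Type*} [Field F] {w d : ℕ} [NeZero d] (k : Fin d)
    (M : Matrix (Fin w) (Fin w) F) (hk : k + 1 ≠ k) (u v : Fin w × Fin w) :
    Bmat F w d k M (k + 1, u) (k + 1, v) = if u.2 = v.2 then - M u.1 v.1 else 0 := by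
  unfold Bmat
  rw [if_neg (fun h => hk h.1), if_pos ⟨rfl, rfl⟩]

theorem Fin.add_one_ne_self {d : ℕ} [NeZero d] (hd : 2 ≤ d) (k : Fin d) : k + 1 ≠ k := by
  obtain ⟨n, rfl⟩ := Nat.exists_eq_add_of_le' hd
  exact fun h => one_ne_zero (add_eq_left.mp h)

/-- Membership of `Bmat k (single a b 1)` in the Lie algebra, coefficientwise. -/
theorem coeff_eq_of_Bmat_mem_lieAlg {F : Type*} [Field F] {w d : ℕ} [NeZero d] (hd : 2 ≤ d)
    {f : MvPolynomial (Fin d × Fin w × Fin w) F} {k : Fin d} {a b : Fin w}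
    (hB : Bmat F w d k (Matrix.single a b 1) ∈ lieAlg f) (s : Fin d → Fin w × Fin w) :
    (if a = (s k).2 then coeff (selectionExp (Function.update s k ((s k).1, b))) f else 0) =
      if b = (s (k + 1)).1 then
        coeff (selectionExp (Function.update s (k + 1) (a, (s (k + 1)).2))) f else 0 := by
  have hk : k + 1 ≠ k := Fin.add_one_ne_self hd k
  have h := sum_coeff_update_eq_zero hB
    (fun a b hab => by
      unfold Bmat
      rw [if_neg (fun h => hab (h.1.trans h.2.symm)), if_neg (fun h => hab (h.1.trans h.2.symm))])
    s
  rw [← Finset.add_sum_erase _ _ (Finset.mem_univ k),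
    ← Finset.add_sum_erase _ _ (Finset.mem_erase.mpr ⟨hk, Finset.mem_univ (k + 1)⟩),
    Finset.sum_eq_zero (s := (Finset.univ.erase k).erase (k + 1)), add_zero] at h
  · simp only [Bmat_left, Bmat_right _ _ hk] at h
    rw [Fintype.sum_prod_type, Fintype.sum_prod_type] at h
    rw [← sub_eq_zero, sub_eq_add_neg]
    refine Eq.trans ?_ h
    congr 1
    · rw [Finset.sum_eq_single (s k).1, Finset.sum_eq_single b]
      · simp [Matrix.single_apply]
      · intro c _ hc
        simp [Ne.symm hc]
      · simp
      · intro c _ hc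
        simp [hc]
      · simp
    · rw [Finset.sum_eq_single a, Finset.sum_eq_single (s (k + 1)).2]
      · simp [Matrix.single_apply]
      · intro c _ hc
        simp [hc]
      · simp
      · intro c _ hc
        simp [Ne.symm hc]
      · simp
  · intro l hl
    simp only [Finset.mem_erase] at hl
    exact Finset.sum_eq_zero fun u _ => by simp [Bmat, hl.1, hl.2.1]

theorem coeff_eq_zero_of_not_path {F : Type*} [Field F] {w d : ℕ} [NeZero d] (hd : 2 ≤ d)
    {f : MvPolynomial (Fin d × Fin w × Fin w) F}
    (hB : ∀ (k : Fin d) (M : Matrix (Fin w) (Fin w) F), Bmat F w d k M ∈ lieAlg f)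
    (s : Fin d → Fin w × Fin w) {k : Fin d} (hs : (s k).2 ≠ (s (k + 1)).1) :
    coeff (selectionExp s) f = 0 := by
  have h := coeff_eq_of_Bmat_mem_lieAlg hd (hB k (Matrix.single (s k).2 (s k).2 1)) s
  simpa [hs] using h

theorem coeff_path_update {F : Type*} [Field F] {w d : ℕ} [NeZero d] (hd : 2 ≤ d)
    {f : MvPolynomial (Fin d × Fin w × Fin w) F}
    (hB : ∀ (k : Fin d) (M : Matrix (Fin w) (Fin w) F), Bmat F w d k M ∈ lieAlg f)
    (p : Fin d → Fin w) (k : Fin d) (a : Fin w) :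
    coeff (selectionExp (pathSelection (Function.update p k a))) f =
      coeff (selectionExp (pathSelection p)) f := by
  obtain ⟨k, rfl⟩ : ∃ l, l + 1 = k := ⟨k - 1, sub_add_cancel k 1⟩
  have hk : k + 1 ≠ k := Fin.add_one_ne_self hd k
  have h := coeff_eq_of_Bmat_mem_lieAlg hd (hB k (Matrix.single a (p (k + 1)) 1))
    (Function.update (pathSelection p) k (p k, a))
  simp only [Function.update_self, Function.update_of_ne hk, Function.update_idem, if_true] at h
  have hp : Function.update (pathSelection p) k (p k, p (k + 1)) = pathSelection p :=
    Function.update_eq_self k (pathSelection p)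
  rw [hp, if_pos (by simp [pathSelection])] at h
  rw [h]
  congr 2
  funext l
  have hl : l + 1 = k + 1 ↔ l = k := add_left_inj 1
  by_cases h1 : l = k + 1
  · subst h1
    simp only [pathSelection, Function.update_self, Function.update_of_ne (hl.not.mpr hk)]
  · by_cases h2 : l = k
    · subst h2
      simp only [pathSelection, Function.update_self, Function.update_of_ne hk.symm]
    · simp only [pathSelection, Function.update_of_ne h1, Function.update_of_ne h2,
        Function.update_of_ne (hl.not.mpr h2)]

theorem coeff_path_eq {F : Type*} [Field F] {w d : ℕ} [NeZero d] (hd : 2 ≤ d)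
    {f : MvPolynomial (Fin d × Fin w × Fin w) F}
    (hB : ∀ (k : Fin d) (M : Matrix (Fin w) (Fin w) F), Bmat F w d k M ∈ lieAlg f)
    (p q : Fin d → Fin w) :
    coeff (selectionExp (pathSelection q)) f = coeff (selectionExp (pathSelection p)) f := by
  have h : ∀ S : Finset (Fin d), coeff (selectionExp (pathSelection (S.piecewise q p))) f =
      coeff (selectionExp (pathSelection p)) f := by
    intro S
    induction S using Finset.induction with
    | empty => simp
    | insert k S _ ih => rw [Finset.piecewise_insert, coeff_path_update hd hB, ih]
  simpa using h Finset.univ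

theorem stmt15 (F : Type*) [Field F] (w d : ℕ) [NeZero d] (hw : 2 ≤ w) (hd : 3 ≤ d)
    (f : MvPolynomial (Fin d × Fin w × Fin w) F) (hf0 : f ≠ 0)
    (hsm : ∀ m ∈ f.support, ∀ k : Fin d,
      (∑ i : Fin w, ∑ j : Fin w, m (k, i, j)) = 1)
    (hB : ∀ (k : Fin d) (M : Matrix (Fin w) (Fin w) F),
      Bmat F w d k M ∈ lieAlg f) :
    ∃ α : F, α ≠ 0 ∧ f = MvPolynomial.C α * trIMM F w d := by
  have hd2 : 2 ≤ d := by omega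
  have : NeZero w := ⟨by omega⟩
  let α := coeff (selectionExp (pathSelection (fun _ : Fin d => (0 : Fin w)))) f
  have heq : f = C α * trIMM F w d := by
    ext m
    rw [coeff_C_mul, coeff_trIMM]
    by_cases hpath : ∃ p : Fin d → Fin w, selectionExp (pathSelection p) = m
    · obtain ⟨p, rfl⟩ := hpath
      rw [Finset.sum_eq_single p (fun q _ hq => if_neg fun h =>
          hq (pathSelection_injective (selectionExp_injective h))) (by simp),
        if_pos rfl, mul_one]
      exact coeff_path_eq hd2 hB _ p
    · rw [Finset.sum_eq_zero fun p _ => if_neg fun h => hpath ⟨p, h⟩, mul_zero]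
      by_contra hm
      obtain ⟨s, rfl⟩ := exists_eq_selectionExp m fun k => by
        rw [Fintype.sum_prod_type]
        exact hsm m (mem_support_iff.mpr hm) k
      refine hpath ⟨fun k => (s k).1, congrArg selectionExp (funext fun k => ?_)⟩
      by_contra hk
      exact hm (coeff_eq_zero_of_not_path hd2 hB s (k := k) fun h => hk (Prod.ext rfl h.symm))
  refine ⟨α, fun hα => hf0 ?_, heq⟩
  rw [heq, hα, C_0, zero_mul]
end
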